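/- Every maximizer of the energy over K_{1,∞} is a translating vortex patch: if ω ∈ K_{1,∞} satisfies E(ω') ≤ E(ω) for all ω' ∈ K_{1,∞}, then ω = 1_{{x ∈ ℝ²₊ : 𝒢[ω](x) − W·x₂ > 0}} a.e. in ℝ²₊, where the traveling speed is W := (4/3)·I_{1,∞} > 0. -/

import Mathlib

open MeasureTheory Real Set NNReal Filter Topology

noncomputable section

/-- The upper half plane `ℝ²₊`. -/
def H : Set (ℝ × ℝ) := {p | 0 < p.2}

/-- The half-plane Green function
`G(x,y) = (1/(4π)) log(1 + 4 x₂ y₂ / |x-y|²)` (Euclidean distance). -/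
def G (x y : ℝ × ℝ) : ℝ :=
  (1 / (4 * π)) * Real.log (1 + 4 * x.2 * y.2 / ((x.1 - y.1) ^ 2 + (x.2 - y.2) ^ 2))

/-- The potential `𝒢[ω](x) = ∫_{ℝ²₊} G(x,y) ω(y) dy`. -/
def Gpot (ω : ℝ × ℝ → ℝ) (x : ℝ × ℝ) : ℝ := ∫ y in H, G x y * ω y

/-- The kinetic energy `E(ω) = (1/2) ∫∫ G(x,y) ω(x) ω(y) dy dx`. -/
def energy (ω : ℝ × ℝ → ℝ) : ℝ :=
  (1 / 2) * ∫ x in H, ∫ y in H, G x y * ω x * ω y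

/-- The `L¹(ℝ²₊)` norm (mass). -/
def norm1 (ω : ℝ × ℝ → ℝ) : ℝ := ∫ x in H, |ω x|

/-- The `L²(ℝ²₊)` norm. -/
def norm2 (ω : ℝ × ℝ → ℝ) : ℝ := (∫ x in H, ω x ^ 2) ^ ((1 : ℝ) / 2)

/-- The impulse `‖x₂ ω‖₁ = ∫_{ℝ²₊} x₂ |ω(x)| dx`. -/
def impulse (ω : ℝ × ℝ → ℝ) : ℝ := ∫ x in H, x.2 * |ω x|

/-- `ω ∈ (L¹ ∩ L²)(ℝ²₊)`. -/
def MemL1L2 (ω : ℝ × ℝ → ℝ) : Prop :=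
  Integrable ω (volume.restrict H) ∧ Integrable (fun x => ω x ^ 2) (volume.restrict H)

/-- Finiteness of the impulse `‖x₂ ω‖₁ < ∞`. -/
def ImpulseFinite (ω : ℝ × ℝ → ℝ) : Prop :=
  Integrable (fun x : ℝ × ℝ => x.2 * |ω x|) (volume.restrict H)

/-- The admissible class `K_M`: patches `ω = 1_A` a.e. on `ℝ²₊` with
impulse `∫_A x₂ = M` and mass `|A| ≤ 1`. -/
def memK (M : ℝ) (ω : ℝ × ℝ → ℝ) : Prop :=
  Integrable ω (volume.restrict H) ∧
  ∃ A : Set (ℝ × ℝ), A ⊆ H ∧ MeasurableSet A ∧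
    (∀ᵐ x ∂volume.restrict H, ω x = A.indicator (fun _ => (1 : ℝ)) x) ∧
    (∫ x in A, x.2) = M ∧ volume A ≤ 1

/-- The admissible class `K_{M,∞}`: patches `ω = 1_A` a.e. on `ℝ²₊` with
impulse `∫_A x₂ = M`, without any mass bound. -/
def memKinf (M : ℝ) (ω : ℝ × ℝ → ℝ) : Prop :=
  Integrable ω (volume.restrict H) ∧
  ∃ A : Set (ℝ × ℝ), A ⊆ H ∧ MeasurableSet A ∧
    (∀ᵐ x ∂volume.restrict H, ω x = A.indicator (fun _ => (1 : ℝ)) x) ∧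
    (∫ x in A, x.2) = M

/-- The relaxed admissible class `K̃_M`: measurable `0 ≤ ω ≤ 1` with
mass `≤ 1` and impulse `≤ M`. -/
def memKt (M : ℝ) (ω : ℝ × ℝ → ℝ) : Prop :=
  Integrable ω (volume.restrict H) ∧
  (∀ᵐ x ∂volume.restrict H, 0 ≤ ω x ∧ ω x ≤ 1) ∧
  norm1 ω ≤ 1 ∧
  Integrable (fun x : ℝ × ℝ => x.2 * |ω x|) (volume.restrict H) ∧
  impulse ω ≤ M

/-- The set of maximizers `S_M` of the energy over `K_M`. -/
def memS (M : ℝ) (ω : ℝ × ℝ → ℝ) : Prop :=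
  memK M ω ∧ ∀ ω' : ℝ × ℝ → ℝ, memK M ω' → energy ω' ≤ energy ω

/-- The maximal energy `I_M` over `K_M`. -/
def Isup (M : ℝ) : ℝ := sSup (energy '' {ω | memK M ω})

/-- The maximal energy `I_{1,∞}` over `K_{1,∞}`. -/
def IsupInf : ℝ := sSup (energy '' {ω | memKinf 1 ω})

/-- The Steiner symmetry condition for a set `Ω ⊆ ℝ²₊`. -/
def SteinerSet (Ω : Set (ℝ × ℝ)) : Prop :=
  (∀ x₁ x₂ : ℝ, 0 < x₂ → (((x₁, x₂) : ℝ × ℝ) ∈ Ω ↔ ((-x₁, x₂) : ℝ × ℝ) ∈ Ω)) ∧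
  (∀ x₂ : ℝ, 0 < x₂ → ∀ a b : ℝ, 0 ≤ a → a ≤ b →
    ((b, x₂) : ℝ × ℝ) ∈ Ω → ((a, x₂) : ℝ × ℝ) ∈ Ω)

/-- The Steiner symmetry condition for a nonnegative function on `ℝ²₊`. -/
def SteinerFn (f : ℝ × ℝ → ℝ) : Prop :=
  (∀ x₁ x₂ : ℝ, 0 < x₂ → f (x₁, x₂) = f (-x₁, x₂)) ∧
  (∀ x₂ : ℝ, 0 < x₂ → ∀ a b : ℝ, 0 ≤ a → a ≤ b → f (b, x₂) ≤ f (a, x₂))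


/-- Admissible patches: measurable subsets of the half plane with finite mass and impulse. -/
structure FinitePatch (A : Set (ℝ × ℝ)) : Prop where
  subset : A ⊆ H
  measurableSet : MeasurableSet A
  volume_ne_top : volume A ≠ ⊤
  integrableOn : IntegrableOn (fun x : ℝ × ℝ => x.2) A

/-- The interaction integral `∫_{A × B} G`. -/
def interaction (A B : Set (ℝ × ℝ)) : ℝ := ∫ z in A ×ˢ B, G z.1 z.2

lemma measurableSet_H : MeasurableSet H := measurableSet_lt measurable_const measurable_snd

lemma measurable_G : Measurable (fun z : (ℝ × ℝ) × (ℝ × ℝ) => G z.1 z.2) := by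
  unfold G; fun_prop

lemma G_comm (x y : ℝ × ℝ) : G x y = G y x := by
  unfold G
  rw [show 4 * x.2 * y.2 / ((x.1 - y.1) ^ 2 + (x.2 - y.2) ^ 2)
    = 4 * y.2 * x.2 / ((y.1 - x.1) ^ 2 + (y.2 - x.2) ^ 2) by congr 1 <;> ring]

lemma G_nonneg {x y : ℝ × ℝ} (hx : x ∈ H) (hy : y ∈ H) : 0 ≤ G x y := by
  have hx : 0 < x.2 := hx
  have hy : 0 < y.2 := hy
  refine mul_nonneg (by positivity) (Real.log_nonneg ?_)
  have : 0 ≤ 4 * x.2 * y.2 / ((x.1 - y.1) ^ 2 + (x.2 - y.2) ^ 2) := by positivity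
  linarith

lemma G_smul {c : ℝ} (hc : 0 < c) (x y : ℝ × ℝ) : G (c • x) (c • y) = G x y := by
  unfold G
  simp only [Prod.smul_fst, Prod.smul_snd, smul_eq_mul]
  rw [show 4 * (c * x.2) * (c * y.2) = c ^ 2 * (4 * x.2 * y.2) by ring,
    show (c * x.1 - c * y.1) ^ 2 + (c * x.2 - c * y.2) ^ 2
      = c ^ 2 * ((x.1 - y.1) ^ 2 + (x.2 - y.2) ^ 2) by ring,
    mul_div_mul_left _ _ (by positivity)]

lemma log_one_add_sq_le {u : ℝ} (hu : 0 ≤ u) : Real.log (1 + u ^ 2) ≤ 2 * u := by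
  calc Real.log (1 + u ^ 2) ≤ Real.log ((1 + u) ^ 2) :=
        Real.log_le_log (by positivity) (by nlinarith)
    _ = 2 * Real.log (1 + u) := by rw [Real.log_pow]; norm_num
    _ ≤ 2 * u := by
        have := Real.log_le_sub_one_of_pos (show 0 < 1 + u by positivity)
        linarith

/-- The truncated singular kernel `1_{‖z‖ < 1} / ‖z‖`. -/
def truncInv (z : ℝ × ℝ) : ℝ := (Iio (1 : ℝ)).indicator (fun r => r⁻¹) ‖z‖

lemma integrable_truncInv : Integrable truncInv := by
  unfold truncInv
  rw [integrable_fun_norm_addHaar volume (f := (Iio (1 : ℝ)).indicator (fun r => r⁻¹))]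
  have h : IntegrableOn ((Iio (1 : ℝ)).indicator (fun _ => (1 : ℝ))) (Ioi 0) := by
    rw [IntegrableOn, integrable_indicator_iff measurableSet_Iio, IntegrableOn,
      Measure.restrict_restrict measurableSet_Iio, Iio_inter_Ioi]
    exact integrableOn_const (by simp)
  refine h.congr_fun (fun r hr => ?_) measurableSet_Ioi
  have hr : 0 < r := hr
  by_cases h1 : r < 1 <;> simp [h1, hr.ne']

lemma truncInv_nonneg (z : ℝ × ℝ) : 0 ≤ truncInv z :=
  Set.indicator_apply_nonneg fun _ => inv_nonneg.2 (norm_nonneg z)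

lemma G_le {x y : ℝ × ℝ} (hx : x ∈ H) (hy : y ∈ H) :
    G x y ≤ (x.2 + y.2) * (truncInv (x - y) + 1) := by
  have hx : 0 < x.2 := hx
  have hy : 0 < y.2 := hy
  have hT := truncInv_nonneg (x - y)
  rcases eq_or_ne x y with rfl | hne
  · have : G x x = 0 := by simp [G]
    rw [this]; positivity
  have hn : 0 < ‖x - y‖ := norm_pos_iff.2 (sub_ne_zero.2 hne)
  have hinv : ‖x - y‖⁻¹ ≤ truncInv (x - y) + 1 := by
    unfold truncInv
    by_cases h1 : ‖x - y‖ < 1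
    · simp [h1]
    · have : ‖x - y‖⁻¹ ≤ 1 := inv_le_one_of_one_le₀ (not_lt.1 h1)
      simpa [h1] using this
  have hd : ‖x - y‖ ^ 2 ≤ (x.1 - y.1) ^ 2 + (x.2 - y.2) ^ 2 := by
    rw [Prod.norm_def]
    rcases max_choice ‖(x - y).1‖ ‖(x - y).2‖ with h | h <;> rw [h] <;>
      simp only [Prod.fst_sub, Prod.snd_sub, Real.norm_eq_abs, sq_abs] <;> nlinarith
  set u := (x.2 + y.2) * ‖x - y‖⁻¹ with hu
  have hu0 : 0 ≤ u := by positivity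
  have hle : 4 * x.2 * y.2 / ((x.1 - y.1) ^ 2 + (x.2 - y.2) ^ 2) ≤ u ^ 2 := by
    calc _ ≤ (x.2 + y.2) ^ 2 / ‖x - y‖ ^ 2 :=
          div_le_div₀ (by positivity) (by nlinarith [sq_nonneg (x.2 - y.2)]) (by positivity) hd
      _ = u ^ 2 := by rw [hu]; field_simp
  have hlog : Real.log (1 + 4 * x.2 * y.2 / ((x.1 - y.1) ^ 2 + (x.2 - y.2) ^ 2)) ≤ 2 * u :=
    (Real.log_le_log (by positivity) (by linarith)).trans (log_one_add_sq_le hu0)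
  have hpi : 1 / (4 * π) ≤ 1 / 2 := by
    apply one_div_le_one_div_of_le <;> linarith [Real.pi_gt_three]
  calc G x y ≤ (1 / (4 * π)) * (2 * u) := mul_le_mul_of_nonneg_left hlog (by positivity)
    _ ≤ (1 / 2) * (2 * u) := mul_le_mul_of_nonneg_right hpi (by positivity)
    _ = u := by ring
    _ ≤ _ := mul_le_mul_of_nonneg_left hinv (by positivity)

namespace FinitePatch

open scoped Pointwise

variable {A B C : Set (ℝ × ℝ)}

lemma mono (hA : FinitePatch A) (hBA : B ⊆ A) (hB : MeasurableSet B) : FinitePatch B :=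
  ⟨hBA.trans hA.subset, hB, measure_ne_top_of_subset hBA hA.volume_ne_top,
    hA.integrableOn.mono_set hBA⟩

lemma union (hA : FinitePatch A) (hB : FinitePatch B) : FinitePatch (A ∪ B) :=
  ⟨union_subset hA.subset hB.subset, hA.measurableSet.union hB.measurableSet,
    measure_union_ne_top hA.volume_ne_top hB.volume_ne_top,
    hA.integrableOn.union hB.integrableOn⟩

lemma integrableOn_G_self (hA : FinitePatch A) :
    IntegrableOn (fun z : (ℝ × ℝ) × (ℝ × ℝ) => G z.1 z.2) (A ×ˢ A) := by
  set f : ℝ × ℝ → ℝ := A.indicator (fun x => x.2)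
  set e : ℝ × ℝ → ℝ := A.indicator (fun _ => 1)
  have hf : Integrable f := hA.integrableOn.integrable_indicator hA.measurableSet
  have he : Integrable e := by
    refine IntegrableOn.integrable_indicator ?_ hA.measurableSet
    exact integrableOn_const hA.volume_ne_top
  have h1 : Integrable (fun p : (ℝ × ℝ) × (ℝ × ℝ) => f p.2 * truncInv (p.1 - p.2)) :=
    Integrable.convolution_integrand (ContinuousLinearMap.mul ℝ ℝ) hf integrable_truncInv
  have h2 : Integrable (fun p : (ℝ × ℝ) × (ℝ × ℝ) => f p.1 * truncInv (p.2 - p.1)) := h1.swap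
  have h3 : Integrable (fun p : (ℝ × ℝ) × (ℝ × ℝ) => f p.1 * e p.2) := hf.mul_prod he
  have h4 : Integrable (fun p : (ℝ × ℝ) × (ℝ × ℝ) => e p.1 * f p.2) := he.mul_prod hf
  refine Integrable.mono' (((h1.add h2).add (h3.add h4)).integrableOn (s := A ×ˢ A))
    measurable_G.aestronglyMeasurable ?_
  filter_upwards [ae_restrict_mem (hA.measurableSet.prod hA.measurableSet)] with z hz
  have hz1 := hA.subset hz.1
  have hz2 := hA.subset hz.2
  rw [Real.norm_of_nonneg (G_nonneg hz1 hz2)]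
  refine (G_le hz1 hz2).trans (le_of_eq ?_)
  have hsym : truncInv (z.2 - z.1) = truncInv (z.1 - z.2) := by
    simp only [truncInv, norm_sub_rev]
  simp only [Pi.add_apply, f, e, Set.indicator_of_mem hz.1, Set.indicator_of_mem hz.2, hsym]
  ring

lemma integrableOn_G (hA : FinitePatch A) (hB : FinitePatch B) :
    IntegrableOn (fun z : (ℝ × ℝ) × (ℝ × ℝ) => G z.1 z.2) (A ×ˢ B) :=
  (hA.union hB).integrableOn_G_self.mono_set
    (prod_mono subset_union_left subset_union_right)

lemma interaction_eq (hA : FinitePatch A) (hB : FinitePatch B) :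
    interaction A B = ∫ x in A, ∫ y in B, G x y :=
  setIntegral_prod _ (hA.integrableOn_G hB)

lemma interaction_union_left (hA : FinitePatch A) (hB : FinitePatch B) (hC : FinitePatch C)
    (hAB : Disjoint A B) : interaction (A ∪ B) C = interaction A C + interaction B C := by
  unfold interaction
  rw [union_prod]
  exact setIntegral_union (hAB.set_prod_left _ _) (hB.measurableSet.prod hC.measurableSet)
    (hA.integrableOn_G hC) (hB.integrableOn_G hC)

lemma interaction_comm (hA : FinitePatch A) (hB : FinitePatch B) :
    interaction A B = interaction B A := by
  have h := hA.integrableOn_G hB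
  rw [hB.interaction_eq hA, hA.interaction_eq hB, integral_integral_swap]
  · simp only [G_comm]
  · rw [Measure.prod_restrict]; exact h

lemma interaction_union_self (hA : FinitePatch A) (hB : FinitePatch B) (hAB : Disjoint A B) :
    interaction (A ∪ B) (A ∪ B)
      = interaction A A + 2 * interaction B A + interaction B B := by
  rw [hA.interaction_union_left hB (hA.union hB) hAB, hA.interaction_comm (hA.union hB),
    hB.interaction_comm (hA.union hB), hA.interaction_union_left hB hA hAB,
    hA.interaction_union_left hB hB hAB, hA.interaction_comm hB]
  ring

lemma interaction_mono (hA : FinitePatch A) (hBA : B ⊆ A) :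
    interaction B B ≤ interaction A A := by
  refine setIntegral_mono_set hA.integrableOn_G_self ?_ (prod_mono hBA hBA).eventuallyLE
  filter_upwards [ae_restrict_mem (hA.measurableSet.prod hA.measurableSet)] with z hz
  exact G_nonneg (hA.subset hz.1) (hA.subset hz.2)

lemma impulse_nonneg (hA : FinitePatch A) : 0 ≤ ∫ x in A, x.2 :=
  setIntegral_nonneg hA.measurableSet fun x hx => (show 0 < x.2 from hA.subset hx).le

lemma volume_eq_zero (hA : FinitePatch A) (h : ∫ x in A, x.2 = 0) : volume A = 0 := by
  by_contra hv
  refine absurd h (ne_of_gt ?_)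
  rw [setIntegral_pos_iff_support_of_nonneg_ae _ hA.integrableOn]
  · have hsupp : A ⊆ Function.support fun x : ℝ × ℝ => x.2 :=
      fun x hx => (show 0 < x.2 from hA.subset hx).ne'
    rw [inter_eq_right.2 hsupp]
    exact pos_iff_ne_zero.2 hv
  · filter_upwards [ae_restrict_mem hA.measurableSet] with x hx
    exact (show 0 < x.2 from hA.subset hx).le

lemma impulse_smul (A : Set (ℝ × ℝ)) {c : ℝ} (hc : 0 < c) :
    ∫ x in c • A, x.2 = c ^ 3 * ∫ x in A, x.2 := by
  have h := Measure.setIntegral_comp_smul_of_pos volume (fun x : ℝ × ℝ => x.2) A hc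
  simp only [Prod.smul_snd, smul_eq_mul, integral_const_mul, Module.finrank_prod,
    Module.finrank_self] at h
  field_simp at h
  rw [← h]; ring

lemma integral_G_smul (A : Set (ℝ × ℝ)) {c : ℝ} (hc : 0 < c) :
    ∫ x in c • A, ∫ y in c • A, G x y = c ^ 4 * ∫ x in A, ∫ y in A, G x y := by
  have h1 := Measure.setIntegral_comp_smul_of_pos volume
    (fun x : ℝ × ℝ => ∫ y in c • A, G x y) A hc
  have h2 : ∀ x, ∫ y in A, G x y = (c ^ 2)⁻¹ * ∫ y in c • A, G (c • x) y := fun x => by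
    have h := Measure.setIntegral_comp_smul_of_pos volume (fun y : ℝ × ℝ => G (c • x) y) A hc
    simpa [G_smul hc, Module.finrank_prod] using h
  simp only [h2, integral_const_mul]
  rw [h1]
  simp only [smul_eq_mul, Module.finrank_prod, Module.finrank_self]
  field_simp

lemma smul (hA : FinitePatch A) {c : ℝ} (hc : 0 < c) : FinitePatch (c • A) where
  subset := by
    rintro _ ⟨x, hx, rfl⟩
    exact mul_pos hc (hA.subset hx)
  measurableSet := hA.measurableSet.const_smul₀ c
  volume_ne_top := by
    rw [Measure.addHaar_smul]
    exact ENNReal.mul_ne_top ENNReal.ofReal_ne_top hA.volume_ne_top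
  integrableOn := by
    rcases eq_or_ne (∫ x in A, x.2) 0 with h | h
    · have h0 : volume (c • A) = 0 := by
        rw [Measure.addHaar_smul, hA.volume_eq_zero h, mul_zero]
      rw [IntegrableOn, Measure.restrict_eq_zero.2 h0]
      exact integrable_zero_measure
    · by_contra hI
      have := impulse_smul A hc
      rw [integral_undef hI] at this
      exact mul_ne_zero (by positivity) h this.symm

lemma memKinf_indicator (hA : FinitePatch A) :
    memKinf (∫ x in A, x.2) (A.indicator fun _ => (1 : ℝ)) := by
  refine ⟨?_, A, hA.subset, hA.measurableSet, ae_of_all _ fun _ => rfl, rfl⟩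
  exact ((integrableOn_const hA.volume_ne_top).integrable_indicator hA.measurableSet).integrableOn

/-- Every set of positive measure contains small patches whose self-interaction dominates
any prescribed multiple of the squared impulse. -/
lemma exists_concentrated {S : Set (ℝ × ℝ)} (hSH : S ⊆ H) (hS : MeasurableSet S)
    (hpos : volume S ≠ 0) {K : ℝ} (hK : 0 ≤ K) :
    ∃ D ⊆ S, FinitePatch D ∧ 0 < ∫ x in D, x.2 ∧
      K * (∫ x in D, x.2) ^ 2 ≤ interaction D D := by
  obtain ⟨p, hpS, hp⟩ := exists_mem_forall_mem_nhdsWithin_pos_measure hpos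
  set h := p.2 with hh
  have hh0 : 0 < h := hSH hpS
  set L := 4 * π * (K * (3 / 2 * h) ^ 2) with hL
  have hL0 : 0 ≤ L := by positivity
  set r := h / 4 * Real.exp (-L / 2) with hr
  have hr0 : 0 < r := by positivity
  have hr1 : r ≤ h / 4 := by
    have : Real.exp (-L / 2) ≤ 1 := Real.exp_le_one_iff.2 (by linarith)
    nlinarith
  have hr2 : r ^ 2 * Real.exp L = h ^ 2 / 16 := by
    rw [hr, mul_pow, ← Real.exp_nat_mul, mul_assoc, ← Real.exp_add]
    rw [show ((2 : ℕ) : ℝ) * (-L / 2) + L = 0 by push_cast; ring, Real.exp_zero]; ring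
  set D := S ∩ Metric.ball p r with hD
  have hDv : 0 < volume D :=
    hp D (inter_mem_nhdsWithin _ (Metric.ball_mem_nhds p hr0))
  have hDm : MeasurableSet D := hS.inter measurableSet_ball
  have hb : ∀ x ∈ D, |x.1 - p.1| < r ∧ |x.2 - h| < r := fun x hx => by
    have : dist x p < r := hx.2
    rw [Prod.dist_eq, max_lt_iff] at this
    exact this
  have hx2 : ∀ x ∈ D, h / 2 ≤ x.2 ∧ x.2 ≤ 3 / 2 * h := fun x hx => by
    have := abs_lt.1 (hb x hx).2
    constructor <;> linarith
  have hDt : volume D ≠ ⊤ := measure_ne_top_of_subset inter_subset_right measure_ball_lt_top.ne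
  have hDP : FinitePatch D := by
    refine ⟨inter_subset_left.trans hSH, hDm, hDt, ?_⟩
    refine Measure.integrableOn_of_bounded (M := 3 / 2 * h) hDt
      measurable_snd.aestronglyMeasurable ?_
    filter_upwards [ae_restrict_mem hDm] with x hx
    have := hx2 x hx
    rw [Real.norm_of_nonneg (by linarith)]
    exact this.2
  have hδ : ∫ x in D, x.2 ≤ 3 / 2 * h * volume.real D := by
    have := setIntegral_mono_on hDP.integrableOn (integrableOn_const hDt (C := 3 / 2 * h)) hDm
      fun x hx => (hx2 x hx).2
    simpa [mul_comm] using this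
  refine ⟨D, inter_subset_left, hDP, ?_, ?_⟩
  · exact hDP.impulse_nonneg.lt_of_ne' fun h0 => hDv.ne' (hDP.volume_eq_zero h0)
  have hG : ∀ x ∈ D, ∀ y ∈ D, x ≠ y → K * (3 / 2 * h) ^ 2 ≤ G x y := fun x hx y hy hxy => by
    have h1 := hb x hx
    have h2 := hb y hy
    have h3 := hx2 x hx
    have h4 := hx2 y hy
    have e1 : (x.1 - y.1) ^ 2 ≤ (2 * r) ^ 2 := by
      apply sq_le_sq' <;> linarith [abs_lt.1 h1.1, abs_lt.1 h2.1]
    have e2 : (x.2 - y.2) ^ 2 ≤ (2 * r) ^ 2 := by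
      apply sq_le_sq' <;> linarith [abs_lt.1 h1.2, abs_lt.1 h2.2]
    have hd : 0 < (x.1 - y.1) ^ 2 + (x.2 - y.2) ^ 2 := by
      by_contra hcon
      refine hxy (Prod.ext ?_ ?_) <;> nlinarith [sq_nonneg (x.1 - y.1), sq_nonneg (x.2 - y.2)]
    have hq : Real.exp L ≤ 4 * x.2 * y.2 / ((x.1 - y.1) ^ 2 + (x.2 - y.2) ^ 2) := by
      rw [le_div_iff₀ hd]
      calc Real.exp L * ((x.1 - y.1) ^ 2 + (x.2 - y.2) ^ 2)
          ≤ Real.exp L * (8 * r ^ 2) :=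
            mul_le_mul_of_nonneg_left (by nlinarith) (Real.exp_pos _).le
        _ = h ^ 2 / 2 := by linarith
        _ ≤ 4 * x.2 * y.2 := by nlinarith
    have hlog : L ≤ Real.log (1 + 4 * x.2 * y.2 / ((x.1 - y.1) ^ 2 + (x.2 - y.2) ^ 2)) := by
      rw [Real.le_log_iff_exp_le (by linarith [Real.exp_pos L])]
      linarith
    calc K * (3 / 2 * h) ^ 2 = 1 / (4 * π) * L := by rw [hL]; field_simp
      _ ≤ G x y := mul_le_mul_of_nonneg_left hlog (by positivity)
  have hdiag : ∀ᵐ z : (ℝ × ℝ) × (ℝ × ℝ), z.1 ≠ z.2 := by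
    have hm : MeasurableSet {z : (ℝ × ℝ) × (ℝ × ℝ) | z.1 = z.2} :=
      measurableSet_eq_fun measurable_fst measurable_snd
    have : (volume : Measure ((ℝ × ℝ) × (ℝ × ℝ))) {z | z.1 = z.2} = 0 := by
      rw [Measure.volume_eq_prod, Measure.measure_prod_null hm]
      refine ae_of_all _ fun x => ?_
      have : Prod.mk x ⁻¹' {z : (ℝ × ℝ) × (ℝ × ℝ) | z.1 = z.2} = {x} := by
        ext y; simp [eq_comm]
      simp [this]
    rw [ae_iff]; simpa using this
  have hvol : volume (D ×ˢ D) ≠ ⊤ := by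
    rw [Measure.volume_eq_prod, Measure.prod_prod]
    exact ENNReal.mul_ne_top hDt hDt
  have hJ := setIntegral_mono_on_ae (integrableOn_const hvol (C := K * (3 / 2 * h) ^ 2))
    hDP.integrableOn_G_self (hDm.prod hDm)
    (hdiag.mono fun z hz hzD => hG z.1 hzD.1 z.2 hzD.2 hz)
  have hreal : volume.real (D ×ˢ D) = volume.real D * volume.real D := by
    rw [Measure.volume_eq_prod, measureReal_prod_prod]
  rw [setIntegral_const, smul_eq_mul, hreal] at hJ
  refine le_trans ?_ hJ
  have := pow_le_pow_left₀ hDP.impulse_nonneg hδ 2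
  nlinarith [mul_le_mul_of_nonneg_left this hK]

end FinitePatch

section Patch

open scoped Pointwise

variable {ω : ℝ × ℝ → ℝ} {A : Set (ℝ × ℝ)}

lemma Gpot_eq (hAH : A ⊆ H) (hA : MeasurableSet A)
    (hω : ∀ᵐ x ∂volume.restrict H, ω x = A.indicator (fun _ => (1 : ℝ)) x) (x : ℝ × ℝ) :
    Gpot ω x = ∫ y in A, G x y := by
  have : Gpot ω x = ∫ y in H, A.indicator (G x) y := by
    refine integral_congr_ae ?_
    filter_upwards [hω] with y hy
    rw [hy]
    by_cases h : y ∈ A <;> simp [h]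
  rw [this, setIntegral_indicator hA, inter_eq_right.2 hAH]

lemma energy_eq (hA : FinitePatch A)
    (hω : ∀ᵐ x ∂volume.restrict H, ω x = A.indicator (fun _ => (1 : ℝ)) x) :
    energy ω = 1 / 2 * interaction A A := by
  have h : ∀ x, ∫ y in H, G x y * ω x * ω y = ω x * Gpot ω x := fun x => by
    rw [Gpot, ← integral_const_mul]
    congr 1; ext y; ring
  have : ∫ x in H, ω x * Gpot ω x
      = ∫ x in H, A.indicator (fun x => ∫ y in A, G x y) x := by
    refine integral_congr_ae ?_
    filter_upwards [hω] with x hx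
    rw [hx, Gpot_eq hA.subset hA.measurableSet hω]
    by_cases h : x ∈ A <;> simp [h]
  rw [energy, hA.interaction_eq hA]
  simp only [h]
  rw [this, setIntegral_indicator hA.measurableSet, inter_eq_right.2 hA.subset]

lemma finitePatch_of_memKinf (hω : Integrable ω (volume.restrict H)) (hAH : A ⊆ H)
    (hA : MeasurableSet A)
    (hωA : ∀ᵐ x ∂volume.restrict H, ω x = A.indicator (fun _ => (1 : ℝ)) x)
    (himp : ∫ x in A, x.2 ≠ 0) : FinitePatch A := by
  refine ⟨hAH, hA, ?_, not_imp_comm.1 integral_undef himp⟩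
  have h1 : IntegrableOn (fun _ => (1 : ℝ)) A := by
    have := hω.congr hωA
    rwa [integrable_indicator_iff hA, IntegrableOn, Measure.restrict_restrict hA,
      inter_eq_left.2 hAH] at this
  rcases (integrableOn_const_iff (by simp)).1 h1 with h | h
  · simp at h
  · exact h.ne

/-- A bound for the energy at unit impulse propagates by scaling to all impulses; the growth
`m ^ (4/3)` is replaced by its quadratic majorant. -/
lemma interaction_le_of_bound {I : ℝ} (hI : 0 ≤ I)
    (hmax : ∀ B, FinitePatch B → ∫ x in B, x.2 = 1 → 1 / 2 * interaction B B ≤ I)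
    {B : Set (ℝ × ℝ)} (hB : FinitePatch B) :
    1 / 2 * interaction B B ≤
      I * ((∫ x in B, x.2) * (2 + ∫ x in B, x.2) / 3) := by
  set m := ∫ x in B, x.2 with hm
  rcases hB.impulse_nonneg.eq_or_lt with h0 | hpos
  · have hv : volume (B ×ˢ B) = 0 := by
      rw [Measure.volume_eq_prod, Measure.prod_prod, hB.volume_eq_zero h0.symm, zero_mul]
    rw [← hm] at h0
    rw [interaction, setIntegral_measure_zero _ hv, ← h0]
    simp
  rw [← hm] at hpos
  obtain ⟨s, hs0, hs⟩ : ∃ s : ℝ, 0 < s ∧ s ^ 3 = m :=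
    ⟨m ^ ((3 : ℕ) : ℝ)⁻¹, by positivity, Real.rpow_inv_natCast_pow hpos.le (by norm_num)⟩
  have hsi : 0 < s⁻¹ := inv_pos.2 hs0
  have himp : ∫ x in s⁻¹ • B, x.2 = 1 := by
    rw [FinitePatch.impulse_smul B hsi, ← hm, ← hs]
    field_simp
  have hE := hmax _ (hB.smul hsi) himp
  rw [(hB.smul hsi).interaction_eq (hB.smul hsi), FinitePatch.integral_G_smul B hsi,
    ← hB.interaction_eq hB] at hE
  have hE' : 1 / 2 * interaction B B ≤ I * s ^ 4 := by
    have := mul_le_mul_of_nonneg_right hE (pow_pos hs0 4).le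
    field_simp at this
    linarith
  refine hE'.trans (mul_le_mul_of_nonneg_left ?_ hI)
  rw [← hs]
  have : 0 ≤ s ^ 3 * ((s - 1) ^ 2 * (s + 2)) := by positivity
  nlinarith

end Patch

/-- every maximizer of the energy over `K_{1,∞}` is a translating vortex
patch with traveling speed `W = (4/3) I_{1,∞} > 0`. -/
theorem maximizer_is_traveling_patch (ω : ℝ × ℝ → ℝ)
    (hω : memKinf 1 ω)
    (hmax : ∀ ω' : ℝ × ℝ → ℝ, memKinf 1 ω' → energy ω' ≤ energy ω) :
    0 < (4 / 3) * IsupInf ∧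
    (∀ᵐ x ∂volume.restrict H,
      ω x = Set.indicator {y ∈ H | 0 < Gpot ω y - ((4 / 3) * IsupInf) * y.2}
        (fun _ => (1 : ℝ)) x) := by
  obtain ⟨hωi, A, hAH, hAm, hωA, himp⟩ := hω
  have hA : FinitePatch A :=
    finitePatch_of_memKinf hωi hAH hAm hωA (by rw [himp]; norm_num)
  have hI : IsupInf = 1 / 2 * interaction A A := by
    rw [← energy_eq hA hωA]
    refine IsGreatest.csSup_eq ⟨⟨ω, ⟨hωi, A, hAH, hAm, hωA, himp⟩, rfl⟩, ?_⟩
    rintro _ ⟨ω', h', rfl⟩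
    exact hmax ω' h'
  set I := IsupInf
  have hI0 : 0 < I := by
    have hv : volume A ≠ 0 := fun h0 => by
      rw [setIntegral_measure_zero _ h0] at himp
      exact zero_ne_one himp
    obtain ⟨D, hDA, -, hδ, hD⟩ := FinitePatch.exists_concentrated hAH hAm hv zero_le_one
    have := hA.interaction_mono hDA
    rw [hI]
    nlinarith [sq_pos_of_pos hδ]
  have hbound : ∀ B, FinitePatch B →
      1 / 2 * interaction B B ≤ I * ((∫ x in B, x.2) * (2 + ∫ x in B, x.2) / 3) := fun B hB => by
    refine interaction_le_of_bound hI0.le (fun B hB hB1 => ?_) hB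
    rw [hI, ← energy_eq hA hωA, ← energy_eq hB (ae_of_all _ fun _ => rfl)]
    exact hmax _ (hB1 ▸ hB.memKinf_indicator)
  have hΨm : Measurable (Gpot ω) := by
    have : Gpot ω = fun x => ∫ y in A, G x y := funext (Gpot_eq hAH hAm hωA)
    rw [this]
    exact (measurable_G.stronglyMeasurable.integral_prod_right
      (f := fun x y : ℝ × ℝ => G x y)).measurable
  have hΨi : ∀ D, FinitePatch D → IntegrableOn (Gpot ω) D := fun D hD => by
    have : Gpot ω = fun x => ∫ y in A, G x y := funext (Gpot_eq hAH hAm hωA)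
    have h := hD.integrableOn_G hA
    rw [IntegrableOn, Measure.volume_eq_prod, ← Measure.prod_restrict] at h
    rw [this]
    exact h.integral_prod_left
  have hJ : ∀ D, FinitePatch D → interaction D A = ∫ x in D, Gpot ω x := fun D hD => by
    rw [hD.interaction_eq hA]
    simp only [Gpot_eq hAH hAm hωA]
  have hWi : ∀ D, FinitePatch D → IntegrableOn (fun x : ℝ × ℝ => 4 / 3 * I * x.2) D :=
    fun D hD => hD.integrableOn.const_mul _
  have hlin : Measurable fun x : ℝ × ℝ => 4 / 3 * I * x.2 := measurable_snd.const_mul _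
  have hin : volume (A ∩ {x | Gpot ω x ≤ 4 / 3 * I * x.2}) = 0 := by
    by_contra hv
    obtain ⟨D, hDS, hD, hδ, hDD⟩ := FinitePatch.exists_concentrated
      (inter_subset_left.trans hAH) (hAm.inter (measurableSet_le hΨm hlin)) hv
      (K := I) hI0.le
    have hDA : D ⊆ A := hDS.trans inter_subset_left
    have hR : FinitePatch (A \ D) := hA.mono sdiff_subset (hAm.diff hD.measurableSet)
    have hΨ := setIntegral_mono_on (hΨi D hD) (hWi D hD) hD.measurableSet
      fun x hx => (hDS hx).2
    rw [← hJ D hD, integral_const_mul] at hΨ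
    have hself := hR.interaction_union_self hD disjoint_sdiff_left
    have hcross := hR.interaction_union_left hD hD disjoint_sdiff_left
    have hm : ∫ x in A \ D, x.2 = 1 - ∫ x in D, x.2 := by
      rw [setIntegral_sdiff hD.measurableSet hA.integrableOn hDA, himp]
    rw [sdiff_union_of_subset hDA] at hself hcross
    rw [hA.interaction_comm hD, hR.interaction_comm hD] at hcross
    have hb := hbound _ hR
    rw [hm] at hb
    nlinarith [mul_pos hI0 (pow_pos hδ 2)]
  have hout : volume ((H \ A) ∩ {x | 4 / 3 * I * x.2 < Gpot ω x}) = 0 := by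
    by_contra hv
    obtain ⟨D, hDS, hD, hδ, hDD⟩ := FinitePatch.exists_concentrated
      (inter_subset_left.trans sdiff_subset)
      ((measurableSet_H.diff hAm).inter (measurableSet_lt hlin hΨm)) hv (K := I) hI0.le
    have hAD : Disjoint A D := disjoint_sdiff_right.mono_right (hDS.trans inter_subset_left)
    have hΨ := setIntegral_mono_on (hWi D hD) (hΨi D hD) hD.measurableSet
      fun x hx => (show _ < _ from (hDS hx).2).le
    rw [← hJ D hD, integral_const_mul] at hΨ
    have hself := hA.interaction_union_self hD hAD
    have hm : ∫ x in A ∪ D, x.2 = 1 + ∫ x in D, x.2 := by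
      rw [setIntegral_union hAD hD.measurableSet hA.integrableOn hD.integrableOn, himp]
    have hb := hbound _ (hA.union hD)
    rw [hm] at hb
    nlinarith [mul_pos hI0 (pow_pos hδ 2)]
  refine ⟨by positivity, ?_⟩
  filter_upwards [hωA, ae_restrict_mem measurableSet_H,
    ae_restrict_of_ae (measure_eq_zero_iff_ae_notMem.1 hin),
    ae_restrict_of_ae (measure_eq_zero_iff_ae_notMem.1 hout)] with x hx hxH h1 h2
  rw [hx]
  by_cases hxA : x ∈ A
  · have hlt : 4 / 3 * I * x.2 < Gpot ω x := not_le.1 fun h => h1 ⟨hxA, h⟩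
    rw [Set.indicator_of_mem hxA, Set.indicator_of_mem]
    exact ⟨hxH, sub_pos.2 hlt⟩
  · rw [Set.indicator_of_notMem hxA, Set.indicator_of_notMem]
    exact fun h => h2 ⟨⟨hxH, hxA⟩, sub_pos.1 h.2⟩
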